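/- arXiv:2501.18067 — 3 statements merged into one kernel-verified Lean document; each statement's English description precedes it below -/
import Mathlib

section
/- The superalgebra (2,2)₃ is supercommutative and satisfies the Jordan superidentity for all homogeneous elements, but it is not associative: (e₁f₁)f₂ = ½e₁ while e₁(f₁f₂) = e₁. -/
namespace JS22

variable (F : Type*) [Field F] [CharZero F]

/-- The underlying ℤ₂-graded vector space `J = F⁴`: coordinates `0,1` are the even
basis vectors `e₁, e₂` and coordinates `2,3` are the odd basis vectors `f₁, f₂`. -/
abbrev J : Type _ := Fin 4 → F

def e1 : J F := ![1, 0, 0, 0]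
def e2 : J F := ![0, 1, 0, 0]
def f1 : J F := ![0, 0, 1, 0]
def f2 : J F := ![0, 0, 0, 1]

/-- The even part `J₀ = span {e₁, e₂}`. -/
def J0 : Submodule F (J F) := Submodule.span F {e1 F, e2 F}

/-- The odd part `J₁ = span {f₁, f₂}`. -/
def J1 : Submodule F (J F) := Submodule.span F {f1 F, f2 F}

/-- `x` is homogeneous of degree `d ∈ {0, 1}`. -/
def IsHomog (x : J F) (d : ℕ) : Prop :=
  (d = 0 ∧ x ∈ J0 F) ∨ (d = 1 ∧ x ∈ J1 F)

/-- A (bilinear) multiplication is supercommutative: `x y = (−1)^{|x||y|} y x`. -/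
def IsSuperComm (mul : J F → J F → J F) : Prop :=
  ∀ x y : J F, ∀ dx dy : ℕ, IsHomog F x dx → IsHomog F y dy →
    mul x y = ((-1 : F) ^ (dx * dy)) • mul y x

/-- The Jordan superidentity, for all homogeneous `w, x, y, z`. -/
def SatisfiesJordanSuperId (mul : J F → J F → J F) : Prop :=
  ∀ w x y z : J F, ∀ dw dx dy dz : ℕ,
    IsHomog F w dw → IsHomog F x dx → IsHomog F y dy → IsHomog F z dz →
    mul (mul w x) (mul y z)
      + ((-1 : F) ^ (dx * dy)) • mul (mul w y) (mul x z)
      + ((-1 : F) ^ ((dx + dy) * dz)) • mul (mul w z) (mul x y)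
      - ((-1 : F) ^ (dw * dx)) • mul x (mul w (mul y z))
      - ((-1 : F) ^ (dy * (dw + dx))) • mul y (mul w (mul x z))
      - ((-1 : F) ^ (dz * (dw + dx + dy))) • mul z (mul w (mul x y)) = 0

/-- `F(a,b,c,d) = h((ab)c, d) + h(ab,c)·d + (h(a,b)·c)·d`. -/
def Fc (mul : J F → J F → J F) (h : J F →ₗ[F] J F →ₗ[F] J F) (a b c d : J F) : J F :=
  h (mul (mul a b) c) d + mul (h (mul a b) c) d + mul (mul (h a b) c) d

/-- `G(a,b,c,d) = h(ab, cd) + h(a,b)·(cd) + (ab)·h(c,d)`. -/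
def Gc (mul : J F → J F → J F) (h : J F →ₗ[F] J F →ₗ[F] J F) (a b c d : J F) : J F :=
  h (mul a b) (mul c d) + mul (h a b) (mul c d) + mul (mul a b) (h c d)

/-- Supersymmetry of `h`: `h(a,b) = (−1)^{|a||b|} h(b,a)` for homogeneous `a, b`. -/
def IsSuperSym (h : J F →ₗ[F] J F →ₗ[F] J F) : Prop :=
  ∀ a b : J F, ∀ da db : ℕ, IsHomog F a da → IsHomog F b db →
    h a b = ((-1 : F) ^ (da * db)) • h b a

/-- The 2-cocycle identity for `h` with respect to the multiplication `mul`. -/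
def IsCocycleId (mul : J F → J F → J F) (h : J F →ₗ[F] J F →ₗ[F] J F) : Prop :=
  ∀ a b c d : J F, ∀ da db dc dd : ℕ,
    IsHomog F a da → IsHomog F b db → IsHomog F c dc → IsHomog F d dd →
    Fc F mul h a b c d + ((-1 : F) ^ (db * (dc + dd) + dc * dd)) • Fc F mul h a d c b
      + ((-1 : F) ^ (da * (db + dc + dd) + dc * dd)) • Fc F mul h b d c a
    = Gc F mul h a b c d + ((-1 : F) ^ (db * dc)) • Gc F mul h a c b d
      + ((-1 : F) ^ (dd * (dc + db))) • Gc F mul h a d b c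

/-- `h` is a supersymmetric 2-cocycle. -/
def IsSuperCocycle (mul : J F → J F → J F) (h : J F →ₗ[F] J F →ₗ[F] J F) : Prop :=
  IsSuperSym F h ∧ IsCocycleId F mul h

/-- `h` is a coboundary: `h(a,b) = a·μ(b) + μ(a)·b − μ(a·b)` for some linear `μ`. -/
def IsCoboundary (mul : J F → J F → J F) (h : J F →ₗ[F] J F →ₗ[F] J F) : Prop :=
  ∃ μ : J F →ₗ[F] J F, ∀ a b : J F, h a b = mul a (μ b) + mul (μ a) b - μ (mul a b)

/-- The bilinear map `h` is even: `h(J_i × J_j) ⊆ J_{i+j}`. -/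
def IsEvenBilin (h : J F →ₗ[F] J F →ₗ[F] J F) : Prop :=
  (∀ a ∈ J0 F, ∀ b ∈ J0 F, h a b ∈ J0 F) ∧
  (∀ a ∈ J0 F, ∀ b ∈ J1 F, h a b ∈ J1 F) ∧
  (∀ a ∈ J1 F, ∀ b ∈ J0 F, h a b ∈ J1 F) ∧
  (∀ a ∈ J1 F, ∀ b ∈ J1 F, h a b ∈ J0 F)

/-- The linear map `μ` is even: `μ(J_i) ⊆ J_i`. -/
def IsEvenLin (μ : J F →ₗ[F] J F) : Prop :=
  (∀ a ∈ J0 F, μ a ∈ J0 F) ∧ (∀ a ∈ J1 F, μ a ∈ J1 F)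

/-- `φ` is a graded algebra isomorphism from `(J, mulA)` onto `(J, mulB)`. -/
def IsGradedIso (mulA mulB : J F → J F → J F) (φ : J F → J F) : Prop :=
  IsLinearMap F φ ∧ Function.Bijective φ ∧
  φ '' (J0 F : Set (J F)) = (J0 F : Set (J F)) ∧
  φ '' (J1 F : Set (J F)) = (J1 F : Set (J F)) ∧
  ∀ x y : J F, φ (mulA x y) = mulB (φ x) (φ y)

/-- `D_γ`: `e₁²=e₁`, `e₂²=e₂`, `eᵢfⱼ = ½fⱼ`, `f₁f₂ = e₁ + γe₂`. -/
def mulD (γ : F) (x y : J F) : J F :=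
  ![x 0 * y 0 + (x 2 * y 3 - x 3 * y 2),
    x 1 * y 1 + γ * (x 2 * y 3 - x 3 * y 2),
    ((x 0 + x 1) * y 2 + x 2 * (y 0 + y 1)) / 2,
    ((x 0 + x 1) * y 3 + x 3 * (y 0 + y 1)) / 2]

/-- `(2,2)₁`: `e₁²=e₁`, `e₂²=e₂`. -/
def mul1 (x y : J F) : J F :=
  ![x 0 * y 0, x 1 * y 1, 0, 0]

/-- `(2,2)₃`: `e₁²=e₁`, `e₂²=e₂`, `e₁f₁=½f₁`, `e₁f₂=½f₂`, `f₁f₂=e₁`. -/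
def mul3 (x y : J F) : J F :=
  ![x 0 * y 0 + (x 2 * y 3 - x 3 * y 2), x 1 * y 1,
    (x 0 * y 2 + x 2 * y 0) / 2, (x 0 * y 3 + x 3 * y 0) / 2]

/-- `(2,2)₅`: `e₁²=e₁`, `e₂²=e₂`, `e₁f₁=f₁`, `e₁f₂=f₂`, `f₁f₂=e₁`. -/
def mul5 (x y : J F) : J F :=
  ![x 0 * y 0 + (x 2 * y 3 - x 3 * y 2), x 1 * y 1,
    x 0 * y 2 + x 2 * y 0, x 0 * y 3 + x 3 * y 0]

/-- `(2,2)₇`: `e₁²=e₁`, `e₂²=e₂`, `eᵢfⱼ=½fⱼ`, `f₁f₂=e₂`. -/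
def mul7 (x y : J F) : J F :=
  ![x 0 * y 0, x 1 * y 1 + (x 2 * y 3 - x 3 * y 2),
    ((x 0 + x 1) * y 2 + x 2 * (y 0 + y 1)) / 2,
    ((x 0 + x 1) * y 3 + x 3 * (y 0 + y 1)) / 2]

/-- `(2,2)₈`: `e₁²=e₁`, `e₂²=e₂`, `e₁f₁=½f₁`. -/
def mul8 (x y : J F) : J F :=
  ![x 0 * y 0, x 1 * y 1, (x 0 * y 2 + x 2 * y 0) / 2, 0]

/-- `(2,2)₂₆`: `e₁²=e₁`, `e₁f₁=½f₁`, `e₁f₂=½f₂`, `f₁f₂=e₁+e₂`. -/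
def mul26 (x y : J F) : J F :=
  ![x 0 * y 0 + (x 2 * y 3 - x 3 * y 2), x 2 * y 3 - x 3 * y 2,
    (x 0 * y 2 + x 2 * y 0) / 2, (x 0 * y 3 + x 3 * y 0) / 2]

/-- `(2,2)₄₃`: `e₁²=e₁`, `e₁e₂=e₂`, `e₁f₁=f₁`, `e₁f₂=f₂`, `f₁f₂=e₁+e₂`. -/
def mul43 (x y : J F) : J F :=
  ![x 0 * y 0 + (x 2 * y 3 - x 3 * y 2),
    x 0 * y 1 + x 1 * y 0 + (x 2 * y 3 - x 3 * y 2),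
    x 0 * y 2 + x 2 * y 0, x 0 * y 3 + x 3 * y 0]

/-- `(2,2)₅₂`: `e₁²=e₁`, `e₁e₂=½e₂`. -/
def mul52 (x y : J F) : J F :=
  ![x 0 * y 0, (x 0 * y 1 + x 1 * y 0) / 2, 0, 0]

/-- `(2,2)₅₇`: `e₁²=e₁`, `e₁e₂=½e₂`, `e₁f₂=f₂`. -/
def mul57 (x y : J F) : J F :=
  ![x 0 * y 0, (x 0 * y 1 + x 1 * y 0) / 2, 0, x 0 * y 3 + x 3 * y 0]

/-- `(2,2)₆₀`: `e₁²=e₁`, `e₁e₂=½e₂`, `e₁f₁=½f₁`, `e₁f₂=½f₂`. -/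
def mul60 (x y : J F) : J F :=
  ![x 0 * y 0, (x 0 * y 1 + x 1 * y 0) / 2,
    (x 0 * y 2 + x 2 * y 0) / 2, (x 0 * y 3 + x 3 * y 0) / 2]

/-- `(2,2)₆₇`: `e₁²=e₁`, `e₁e₂=½e₂`, `e₁f₁=f₁`, `e₁f₂=f₂`. -/
def mul67 (x y : J F) : J F :=
  ![x 0 * y 0, (x 0 * y 1 + x 1 * y 0) / 2,
    x 0 * y 2 + x 2 * y 0, x 0 * y 3 + x 3 * y 0]


theorem homog_cases {x : J F} {d : ℕ} (h : IsHomog F x d) :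
    (d = 0 ∧ ∃ a b : F, x = ![a, b, 0, 0]) ∨ (d = 1 ∧ ∃ a b : F, x = ![0, 0, a, b]) := by
  rcases h with ⟨hd, hx⟩ | ⟨hd, hx⟩
  · left
    obtain ⟨a, b, rfl⟩ := Submodule.mem_span_pair.1 hx
    refine ⟨hd, a, b, ?_⟩
    ext i; fin_cases i <;> simp [e1, e2]
  · right
    obtain ⟨a, b, rfl⟩ := Submodule.mem_span_pair.1 hx
    refine ⟨hd, a, b, ?_⟩
    ext i; fin_cases i <;> simp [f1, f2]

theorem mul3_mk (a b c d a' b' c' d' : F) :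
    mul3 F ![a, b, c, d] ![a', b', c', d'] =
      ![a * a' + (c * d' - d * c'), b * b', (a * c' + c * a') / 2, (a * d' + d * a') / 2] := by
  rfl

theorem superComm3 : IsSuperComm F (mul3 F) := by
  intro x y dx dy hx hy
  rcases homog_cases F hx with ⟨rfl, a, b, rfl⟩ | ⟨rfl, a, b, rfl⟩ <;>
  rcases homog_cases F hy with ⟨rfl, c, d, rfl⟩ | ⟨rfl, c, d, rfl⟩ <;>
  · simp only [mul3_mk]
    ext i; fin_cases i <;> simp <;> ring

set_option maxHeartbeats 4000000 in
theorem jordan3 : SatisfiesJordanSuperId F (mul3 F) := by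
  intro w x y z dw dx dy dz hw hx hy hz
  rcases homog_cases F hw with ⟨rfl, a, b, rfl⟩ | ⟨rfl, a, b, rfl⟩ <;>
  rcases homog_cases F hx with ⟨rfl, c, d, rfl⟩ | ⟨rfl, c, d, rfl⟩ <;>
  rcases homog_cases F hy with ⟨rfl, p, q, rfl⟩ | ⟨rfl, p, q, rfl⟩ <;>
  rcases homog_cases F hz with ⟨rfl, r, s, rfl⟩ | ⟨rfl, r, s, rfl⟩ <;>
  · simp only [mul3_mk]
    ext i; fin_cases i <;> simp <;> ring

/-- `(2,2)₃` is supercommutative and Jordan, but not associative: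
`(e₁f₁)f₂ = ½e₁` while `e₁(f₁f₂) = e₁`. -/
theorem alg3_Jordan_not_associative :
    IsSuperComm F (mul3 F) ∧ SatisfiesJordanSuperId F (mul3 F) ∧
    mul3 F (mul3 F (e1 F) (f1 F)) (f2 F) = ((1 : F) / 2) • e1 F ∧
    mul3 F (e1 F) (mul3 F (f1 F) (f2 F)) = e1 F ∧
    mul3 F (mul3 F (e1 F) (f1 F)) (f2 F) ≠ mul3 F (e1 F) (mul3 F (f1 F) (f2 F)) := by
  have h1 : mul3 F (mul3 F (e1 F) (f1 F)) (f2 F) = ((1 : F) / 2) • e1 F := by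
    simp only [e1, f1, f2, mul3_mk]
    ext i; fin_cases i <;> simp
  have h2 : mul3 F (e1 F) (mul3 F (f1 F) (f2 F)) = e1 F := by
    simp only [e1, f1, f2, mul3_mk]
    ext i; fin_cases i <;> simp
  refine ⟨superComm3 F, jordan3 F, h1, h2, ?_⟩
  rw [h1, h2]
  intro h
  have h0 := congrFun h 0
  simp [e1] at h0

end JS22
end

section
/- Let J be the superalgebra (2,2)₃. Every supersymmetric 2-cocycle h : J × J → J is a coboundary; that is, the second cohomology group H²(J,J) vanishes. -/
namespace JS22

variable (F : Type*) [Field F] [CharZero F]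

set_option maxHeartbeats 4000000
set_option linter.all false
set_option linter.unusedSectionVars false
set_option linter.unusedSimpArgs false
set_option linter.flexible false

lemma hom_e1 : IsHomog F (e1 F) 0 := Or.inl ⟨rfl, Submodule.subset_span (by simp)⟩
lemma hom_e2 : IsHomog F (e2 F) 0 := Or.inl ⟨rfl, Submodule.subset_span (by simp)⟩
lemma hom_f1 : IsHomog F (f1 F) 1 := Or.inr ⟨rfl, Submodule.subset_span (by simp)⟩
lemma hom_f2 : IsHomog F (f2 F) 1 := Or.inr ⟨rfl, Submodule.subset_span (by simp)⟩

/-- Expansion of a vector in the basis. -/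
lemma expand (x : J F) :
    x = x 0 • e1 F + x 1 • e2 F + x 2 • f1 F + x 3 • f2 F := by
  ext k; fin_cases k <;> simp [e1, e2, f1, f2]

/-- `mul3` in terms of basis vectors. -/
lemma mul3_expand (x y : J F) :
    mul3 F x y = (x 0 * y 0 + (x 2 * y 3 - x 3 * y 2)) • e1 F + (x 1 * y 1) • e2 F
      + ((x 0 * y 2 + x 2 * y 0) / 2) • f1 F + ((x 0 * y 3 + x 3 * y 0) / 2) • f2 F := by
  ext k; fin_cases k <;> simp [mul3, e1, e2, f1, f2]

lemma m_e1_e1 : mul3 F (e1 F) (e1 F) = e1 F := by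
  ext k; fin_cases k <;> simp [mul3, e1, e2, f1, f2]
lemma m_e1_e2 : mul3 F (e1 F) (e2 F) = 0 := by
  ext k; fin_cases k <;> simp [mul3, e1, e2, f1, f2]
lemma m_e1_f1 : mul3 F (e1 F) (f1 F) = (1/2 : F) • f1 F := by
  ext k; fin_cases k <;> simp [mul3, e1, e2, f1, f2]
lemma m_e1_f2 : mul3 F (e1 F) (f2 F) = (1/2 : F) • f2 F := by
  ext k; fin_cases k <;> simp [mul3, e1, e2, f1, f2]
lemma m_e2_e1 : mul3 F (e2 F) (e1 F) = 0 := by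
  ext k; fin_cases k <;> simp [mul3, e1, e2, f1, f2]
lemma m_e2_e2 : mul3 F (e2 F) (e2 F) = e2 F := by
  ext k; fin_cases k <;> simp [mul3, e1, e2, f1, f2]
lemma m_e2_f1 : mul3 F (e2 F) (f1 F) = 0 := by
  ext k; fin_cases k <;> simp [mul3, e1, e2, f1, f2]
lemma m_e2_f2 : mul3 F (e2 F) (f2 F) = 0 := by
  ext k; fin_cases k <;> simp [mul3, e1, e2, f1, f2]
lemma m_f1_e1 : mul3 F (f1 F) (e1 F) = (1/2 : F) • f1 F := by
  ext k; fin_cases k <;> simp [mul3, e1, e2, f1, f2]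
lemma m_f1_e2 : mul3 F (f1 F) (e2 F) = 0 := by
  ext k; fin_cases k <;> simp [mul3, e1, e2, f1, f2]
lemma m_f1_f1 : mul3 F (f1 F) (f1 F) = 0 := by
  ext k; fin_cases k <;> simp [mul3, e1, e2, f1, f2]
lemma m_f1_f2 : mul3 F (f1 F) (f2 F) = e1 F := by
  ext k; fin_cases k <;> simp [mul3, e1, e2, f1, f2]
lemma m_f2_e1 : mul3 F (f2 F) (e1 F) = (1/2 : F) • f2 F := by
  ext k; fin_cases k <;> simp [mul3, e1, e2, f1, f2]
lemma m_f2_e2 : mul3 F (f2 F) (e2 F) = 0 := by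
  ext k; fin_cases k <;> simp [mul3, e1, e2, f1, f2]
lemma m_f2_f1 : mul3 F (f2 F) (f1 F) = - e1 F := by
  ext k; fin_cases k <;> simp [mul3, e1, e2, f1, f2]
lemma m_f2_f2 : mul3 F (f2 F) (f2 F) = 0 := by
  ext k; fin_cases k <;> simp [mul3, e1, e2, f1, f2]
lemma zm_e1 : mul3 F 0 (e1 F) = 0 := by
  ext k; fin_cases k <;> simp [mul3, e1, e2, f1, f2]
lemma zm_e2 : mul3 F 0 (e2 F) = 0 := by
  ext k; fin_cases k <;> simp [mul3, e1, e2, f1, f2]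
lemma zm_f1 : mul3 F 0 (f1 F) = 0 := by
  ext k; fin_cases k <;> simp [mul3, e1, e2, f1, f2]
lemma zm_f2 : mul3 F 0 (f2 F) = 0 := by
  ext k; fin_cases k <;> simp [mul3, e1, e2, f1, f2]

lemma m_smul_left (c : F) (x y : J F) : mul3 F (c • x) y = c • mul3 F x y := by
  ext k; fin_cases k <;> simp [mul3] <;> ring
lemma m_smul_right (c : F) (x y : J F) : mul3 F x (c • y) = c • mul3 F x y := by
  ext k; fin_cases k <;> simp [mul3] <;> ring
lemma m_neg_left (x y : J F) : mul3 F (-x) y = - mul3 F x y := by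
  ext k; fin_cases k <;> simp [mul3] <;> ring
lemma m_neg_right (x y : J F) : mul3 F x (-y) = - mul3 F x y := by
  ext k; fin_cases k <;> simp [mul3] <;> ring
lemma m_zero_left (y : J F) : mul3 F 0 y = 0 := by
  ext k; fin_cases k <;> simp [mul3]
lemma m_zero_right (y : J F) : mul3 F y 0 = 0 := by
  ext k; fin_cases k <;> simp [mul3]
lemma r_e1 (x : J F) : mul3 F x (e1 F) = ![x 0, 0, x 2 / 2, x 3 / 2] := by
  ext k; fin_cases k <;> simp [mul3, e1]
lemma r_e2 (x : J F) : mul3 F x (e2 F) = ![0, x 1, 0, 0] := by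
  ext k; fin_cases k <;> simp [mul3, e2]
lemma r_f1 (x : J F) : mul3 F x (f1 F) = ![- x 3, 0, x 0 / 2, 0] := by
  ext k; fin_cases k <;> simp [mul3, f1]
lemma r_f2 (x : J F) : mul3 F x (f2 F) = ![x 2, 0, 0, x 0 / 2] := by
  ext k; fin_cases k <;> simp [mul3, f2]
lemma l_e1 (x : J F) : mul3 F (e1 F) x = ![x 0, 0, x 2 / 2, x 3 / 2] := by
  ext k; fin_cases k <;> simp [mul3, e1]
lemma l_e2 (x : J F) : mul3 F (e2 F) x = ![0, x 1, 0, 0] := by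
  ext k; fin_cases k <;> simp [mul3, e2]
lemma l_f1 (x : J F) : mul3 F (f1 F) x = ![x 3, 0, x 0 / 2, 0] := by
  ext k; fin_cases k <;> simp [mul3, f1]
lemma l_f2 (x : J F) : mul3 F (f2 F) x = ![- x 2, 0, 0, x 0 / 2] := by
  ext k; fin_cases k <;> simp [mul3, f2]

/-- every supersymmetric 2-cocycle of `(2,2)₃` is a coboundary,
i.e. `H²(J, J) = 0`. -/
theorem H2_vanishes_mul3 (h : J F →ₗ[F] J F →ₗ[F] J F)
    (hc : IsSuperCocycle F (mul3 F) h) :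
    IsCoboundary F (mul3 F) h := by
  obtain ⟨hs, hc⟩ := hc
  have s10 := hs (e2 F) (e1 F) 0 0 (hom_e2 F) (hom_e1 F)
  have s20 := hs (f1 F) (e1 F) 1 0 (hom_f1 F) (hom_e1 F)
  have s21 := hs (f1 F) (e2 F) 1 0 (hom_f1 F) (hom_e2 F)
  have s22 := hs (f1 F) (f1 F) 1 1 (hom_f1 F) (hom_f1 F)
  have s30 := hs (f2 F) (e1 F) 1 0 (hom_f2 F) (hom_e1 F)
  have s31 := hs (f2 F) (e2 F) 1 0 (hom_f2 F) (hom_e2 F)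
  have s32 := hs (f2 F) (f1 F) 1 1 (hom_f2 F) (hom_f1 F)
  have s33 := hs (f2 F) (f2 F) 1 1 (hom_f2 F) (hom_f2 F)
  simp only [mul_zero, mul_one, zero_mul, pow_zero, pow_one, one_smul, neg_smul] at s10 s20 s21 s22 s30 s31 s32 s33
  have z2 : h (f1 F) (f1 F) = 0 := by
    ext k
    have := congrFun s22 k
    simp only [Pi.neg_apply, Pi.zero_apply] at this ⊢
    linear_combination (1 / 2 : F) * this
  have z3 : h (f2 F) (f2 F) = 0 := by
    ext k
    have := congrFun s33 k
    simp only [Pi.neg_apply, Pi.zero_apply] at this ⊢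
    linear_combination (1 / 2 : F) * this
  have q0123 := hc _ _ _ _ _ _ _ _ (hom_e1 F) (hom_e2 F) (hom_f1 F) (hom_f2 F)
  have q1102 := hc _ _ _ _ _ _ _ _ (hom_e2 F) (hom_e2 F) (hom_e1 F) (hom_f1 F)
  have q0113 := hc _ _ _ _ _ _ _ _ (hom_e1 F) (hom_e2 F) (hom_e2 F) (hom_f2 F)
  have q0200 := hc _ _ _ _ _ _ _ _ (hom_e1 F) (hom_f1 F) (hom_e1 F) (hom_e1 F)
  have q0300 := hc _ _ _ _ _ _ _ _ (hom_e1 F) (hom_f2 F) (hom_e1 F) (hom_e1 F)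
  have q1001 := hc _ _ _ _ _ _ _ _ (hom_e2 F) (hom_e1 F) (hom_e1 F) (hom_e2 F)
  have q0203 := hc _ _ _ _ _ _ _ _ (hom_e1 F) (hom_f1 F) (hom_e1 F) (hom_f2 F)
  have q2300 := hc _ _ _ _ _ _ _ _ (hom_f1 F) (hom_f2 F) (hom_e1 F) (hom_e1 F)
  have q0031 := hc _ _ _ _ _ _ _ _ (hom_e1 F) (hom_e1 F) (hom_f2 F) (hom_e2 F)
  simp only [Fc, Gc, m_e1_e1, m_e1_e2, m_e1_f1, m_e1_f2, m_e2_e1, m_e2_e2, m_e2_f1, m_e2_f2, m_f1_e1, m_f1_e2, m_f1_f1, m_f1_f2, m_f2_e1, m_f2_e2, m_f2_f1, m_f2_f2, m_smul_left, m_smul_right, m_neg_left, m_neg_right,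
    m_zero_left, m_zero_right, map_smul, map_neg, map_zero, LinearMap.smul_apply,
    LinearMap.neg_apply, LinearMap.zero_apply, s10, s20, s21, s30, s31, s32, z2, z3] at q0123 q1102 q0113 q0200 q0300 q1001 q0203 q2300 q0031
  simp only [r_e1, r_e2, r_f1, r_f2, l_e1, l_e2, l_f1, l_f2] at q0123 q1102 q0113 q0200 q0300 q1001 q0203 q2300 q0031
  clear hs hc s22 s33
  have q0123_0 := congrFun q0123 0
  have q0123_1 := congrFun q0123 1
  have q0123_2 := congrFun q0123 2
  have q0123_3 := congrFun q0123 3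
  have q1102_0 := congrFun q1102 0
  have q1102_1 := congrFun q1102 1
  have q1102_2 := congrFun q1102 2
  have q1102_3 := congrFun q1102 3
  have q0113_0 := congrFun q0113 0
  have q0113_1 := congrFun q0113 1
  have q0113_2 := congrFun q0113 2
  have q0113_3 := congrFun q0113 3
  have q0200_0 := congrFun q0200 0
  have q0200_1 := congrFun q0200 1
  have q0200_2 := congrFun q0200 2
  have q0200_3 := congrFun q0200 3
  have q0300_0 := congrFun q0300 0
  have q0300_1 := congrFun q0300 1
  have q0300_2 := congrFun q0300 2
  have q0300_3 := congrFun q0300 3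
  have q1001_0 := congrFun q1001 0
  have q1001_1 := congrFun q1001 1
  have q1001_2 := congrFun q1001 2
  have q1001_3 := congrFun q1001 3
  have q0203_0 := congrFun q0203 0
  have q0203_1 := congrFun q0203 1
  have q0203_2 := congrFun q0203 2
  have q0203_3 := congrFun q0203 3
  have q2300_0 := congrFun q2300 0
  have q2300_1 := congrFun q2300 1
  have q2300_2 := congrFun q2300 2
  have q2300_3 := congrFun q2300 3
  have q0031_0 := congrFun q0031 0
  have q0031_1 := congrFun q0031 1
  have q0031_2 := congrFun q0031 2
  have q0031_3 := congrFun q0031 3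
  clear q0123 q1102 q0113 q0200 q0300 q1001 q0203 q2300 q0031
  simp only [Pi.add_apply, Pi.smul_apply, Pi.neg_apply, Pi.zero_apply, smul_eq_mul] at q0123_0 q0123_1 q0123_2 q0123_3 q1102_0 q1102_1 q1102_2 q1102_3 q0113_0 q0113_1 q0113_2 q0113_3 q0200_0 q0200_1 q0200_2 q0200_3 q0300_0 q0300_1 q0300_2 q0300_3 q1001_0 q1001_1 q1001_2 q1001_3 q0203_0 q0203_1 q0203_2 q0203_3 q2300_0 q2300_1 q2300_2 q2300_3 q0031_0 q0031_1 q0031_2 q0031_3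
  simp at q0123_0 q0123_1 q0123_2 q0123_3 q1102_0 q1102_1 q1102_2 q1102_3 q0113_0 q0113_1 q0113_2 q0113_3 q0200_0 q0200_1 q0200_2 q0200_3 q0300_0 q0300_1 q0300_2 q0300_3 q1001_0 q1001_1 q1001_2 q1001_3 q0203_0 q0203_1 q0203_2 q0203_3 q2300_0 q2300_1 q2300_2 q2300_3 q0031_0 q0031_1 q0031_2 q0031_3
  have t002 : h (e1 F) (e1 F) 2 = 0 := by grind
  have t003 : h (e1 F) (e1 F) 3 = 0 := by grind
  have t010 : h (e1 F) (e2 F) 0 = - h (e2 F) (e2 F) 0 := by grind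
  have t011 : h (e1 F) (e2 F) 1 = - h (e1 F) (e1 F) 1 := by grind
  have t012 : h (e1 F) (e2 F) 2 = 0 := by grind
  have t013 : h (e1 F) (e2 F) 3 = 0 := by grind
  have t020 : h (e1 F) (f1 F) 0 = 0 := by grind
  have t022 : h (e1 F) (f1 F) 2 = h (e1 F) (e1 F) 0 / 2 := by grind
  have t023 : h (e1 F) (f1 F) 3 = 0 := by grind
  have t030 : h (e1 F) (f2 F) 0 = 0 := by grind
  have t032 : h (e1 F) (f2 F) 2 = 0 := by grind
  have t033 : h (e1 F) (f2 F) 3 = h (e1 F) (e1 F) 0 / 2 := by grind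
  have t112 : h (e2 F) (e2 F) 2 = 0 := by grind
  have t113 : h (e2 F) (e2 F) 3 = 0 := by grind
  have t120 : h (e2 F) (f1 F) 0 = 0 := by grind
  have t121 : h (e2 F) (f1 F) 1 = -2 * h (e1 F) (f1 F) 1 := by grind
  have t122 : h (e2 F) (f1 F) 2 = - h (e2 F) (e2 F) 0 / 2 := by grind
  have t123 : h (e2 F) (f1 F) 3 = 0 := by grind
  have t130 : h (e2 F) (f2 F) 0 = 0 := by grind
  have t131 : h (e2 F) (f2 F) 1 = -2 * h (e1 F) (f2 F) 1 := by grind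
  have t132 : h (e2 F) (f2 F) 2 = 0 := by grind
  have t133 : h (e2 F) (f2 F) 3 = - h (e2 F) (e2 F) 0 / 2 := by grind
  have t231 : h (f1 F) (f2 F) 1 = h (e1 F) (e1 F) 1 := by grind
  have t232 : h (f1 F) (f2 F) 2 = 0 := by grind
  have t233 : h (f1 F) (f2 F) 3 = 0 := by grind
  clear q0123_0 q0123_1 q0123_2 q0123_3 q1102_0 q1102_1 q1102_2 q1102_3 q0113_0 q0113_1 q0113_2 q0113_3 q0200_0 q0200_1 q0200_2 q0200_3 q0300_0 q0300_1 q0300_2 q0300_3 q1001_0 q1001_1 q1001_2 q1001_3 q0203_0 q0203_1 q0203_2 q0203_3 q2300_0 q2300_1 q2300_2 q2300_3 q0031_0 q0031_1 q0031_2 q0031_3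
  let μ : J F →ₗ[F] J F :=
    { toFun := fun x => ![x 0 * h (e1 F) (e1 F) 0 - x 1 * h (e2 F) (e2 F) 0,
        - x 0 * h (e1 F) (e1 F) 1 + x 1 * h (e2 F) (e2 F) 1 - 2 * x 2 * h (e1 F) (f1 F) 1 - 2 * x 3 * h (e1 F) (f2 F) 1,
        x 2 * (h (e1 F) (e1 F) 0 + h (f1 F) (f2 F) 0), 0]
      map_add' := by intro x y; ext k; fin_cases k <;> simp <;> ring
      map_smul' := by intro c x; ext k; fin_cases k <;> simp <;> ring }
  have hμ : ∀ x, μ x = ![x 0 * h (e1 F) (e1 F) 0 - x 1 * h (e2 F) (e2 F) 0,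
        - x 0 * h (e1 F) (e1 F) 1 + x 1 * h (e2 F) (e2 F) 1 - 2 * x 2 * h (e1 F) (f1 F) 1 - 2 * x 3 * h (e1 F) (f2 F) 1,
        x 2 * (h (e1 F) (e1 F) 0 + h (f1 F) (f2 F) 0), 0] := fun _ => rfl
  clear_value μ
  refine ⟨μ, fun a b => ?_⟩
  have hab : h a b = h (a 0 • e1 F + a 1 • e2 F + a 2 • f1 F + a 3 • f2 F)
      (b 0 • e1 F + b 1 • e2 F + b 2 • f1 F + b 3 • f2 F) := by
    rw [← expand F a, ← expand F b]
  rw [hab, hμ a, hμ b, hμ]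
  simp only [map_add, map_smul, LinearMap.add_apply, LinearMap.smul_apply, s10, s20, s21, s30, s31, s32, z2, z3]
  ext k
  simp only [Pi.add_apply, Pi.sub_apply, Pi.smul_apply, Pi.neg_apply, Pi.zero_apply, smul_eq_mul]
  fin_cases k <;> simp [mul3, t002, t003, t010, t011, t012, t013, t020, t022, t023, t030, t032, t033, t112, t113, t120, t121, t122, t123, t130, t131, t132, t133, t231, t232, t233] <;> ring

end JS22
end

section
/- Let J be the superalgebra (2,2)₈. The bilinear map h : J × J → J defined on basis vectors by h(f₁,f₂) = f₁, h(f₂,f₁) = −f₁, and h = 0 on all other pairs of basis vectors, is a supersymmetric 2-cocycle which is not a coboundary: there is no F-linear map μ : J → J with h(a,b) = aμ(b) + μ(a)b − μ(ab) for all a, b. In particular, the second cohomology group H²(J,J) does not vanish. -/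
namespace JS22

variable (F : Type*) [Field F] [CharZero F]

/-- The bilinear map `h` with `h(f₁,f₂) = f₁`, `h(f₂,f₁) = −f₁` and `h = 0` on all
other pairs of basis vectors, i.e. `h(x,y) = (x₂y₃ − x₃y₂) f₁`. -/
def h8 : J F →ₗ[F] J F →ₗ[F] J F :=
  LinearMap.mk₂ F (fun x y => (x 2 * y 3 - x 3 * y 2) • f1 F)
    (fun m₁ m₂ n => by
      simp only [Pi.add_apply]; rw [← add_smul]; congr 1; ring)
    (fun c m n => by
      simp only [Pi.smul_apply, smul_eq_mul, smul_smul]; congr 1; ring)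
    (fun m n₁ n₂ => by
      simp only [Pi.add_apply]; rw [← add_smul]; congr 1; ring)
    (fun c m n => by
      simp only [Pi.smul_apply, smul_eq_mul, smul_smul]; congr 1; ring)

theorem aux_J0 {x : J F} (h : x ∈ J0 F) : x 2 = 0 ∧ x 3 = 0 := by
  obtain ⟨a, b, rfl⟩ := Submodule.mem_span_pair.1 h
  simp [e1, e2]

theorem aux_J1 {x : J F} (h : x ∈ J1 F) : x 0 = 0 ∧ x 1 = 0 := by
  obtain ⟨a, b, rfl⟩ := Submodule.mem_span_pair.1 h
  simp [f1, f2]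

theorem aux_h8 (x y : J F) : h8 F x y = ![0, 0, x 2 * y 3 - x 3 * y 2, 0] := by
  ext i
  fin_cases i <;> simp [h8, f1]

set_option maxHeartbeats 8000000 in
/-- for `J = (2,2)₈`, the map `h8` is a supersymmetric 2-cocycle which is
not a coboundary; in particular `H²(J,J) ≠ 0`. -/
theorem alg8_nonvanishing_H2 :
    h8 F (f1 F) (f2 F) = f1 F ∧ h8 F (f2 F) (f1 F) = - f1 F ∧
    IsSuperCocycle F (mul8 F) (h8 F) ∧ ¬ IsCoboundary F (mul8 F) (h8 F) := by
  refine ⟨?_, ?_, ⟨?_, ?_⟩, ?_⟩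
  · rw [aux_h8]; simp [f1, f2]
  · rw [aux_h8]; simp [f1, f2]
  · rintro a b da db (⟨rfl, ha⟩ | ⟨rfl, ha⟩) (⟨rfl, hb⟩ | ⟨rfl, hb⟩) <;>
    first | replace ha := aux_J0 F ha | replace ha := aux_J1 F ha
    all_goals first | replace hb := aux_J0 F hb | replace hb := aux_J1 F hb
    all_goals
      obtain ⟨ha, ha'⟩ := ha
      obtain ⟨hb, hb'⟩ := hb
      simp [aux_h8, ha, ha', hb, hb', mul_comm]
  · rintro a b c d da db dc dd (⟨rfl, ha⟩ | ⟨rfl, ha⟩) (⟨rfl, hb⟩ | ⟨rfl, hb⟩)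
      (⟨rfl, hc⟩ | ⟨rfl, hc⟩) (⟨rfl, hd⟩ | ⟨rfl, hd⟩) <;>
    first | replace ha := aux_J0 F ha | replace ha := aux_J1 F ha
    all_goals first | replace hb := aux_J0 F hb | replace hb := aux_J1 F hb
    all_goals first | replace hc := aux_J0 F hc | replace hc := aux_J1 F hc
    all_goals first | replace hd := aux_J0 F hd | replace hd := aux_J1 F hd
    all_goals
      obtain ⟨ha, ha'⟩ := ha
      obtain ⟨hb, hb'⟩ := hb
      obtain ⟨hc, hc'⟩ := hc
      obtain ⟨hd, hd'⟩ := hd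
      ext i
      fin_cases i <;>
        simp [Fc, Gc, mul8, aux_h8, ha, ha', hb, hb', hc, hc', hd, hd'] <;> ring
  · rintro ⟨μ, hμ⟩
    have h1 := congrFun (hμ (f1 F) (f2 F)) 2
    have h2 := congrFun (hμ (f2 F) (e1 F)) 0
    have z1 : mul8 F (f1 F) (f2 F) = 0 := by
      ext i; fin_cases i <;> simp [mul8, f1, f2]
    have z2 : mul8 F (f2 F) (e1 F) = 0 := by
      ext i; fin_cases i <;> simp [mul8, f2, e1]
    rw [z1, map_zero, aux_h8] at h1
    rw [z2, map_zero, aux_h8] at h2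
    simp [mul8, f1, f2, e1] at h1 h2
    rw [← h2] at h1
    simp at h1

end JS22
end
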